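/- arXiv:2507.15564 — 3 statements merged into one kernel-verified Lean document; each statement's English description precedes it below -/
import Mathlib

section
/- Let H be a real Hilbert space, R an operator with domain dom(R) ⊆ H, and α a nonzero real number. Define αR on dom(R) by (αR)u := α·(Ru), and define Rα on α⁻¹·dom(R) by (Rα)u := R(α·u). Then SRG(αR) = α·SRG(R) and SRG(Rα) = α·SRG(R), where α·S := { α·z : z ∈ S }. -/
open MeasureTheory Complex Set
open scoped ENNReal Classical

/-- The set `z_R(u₁,u₂) = { (‖Ru₁−Ru₂‖/‖u₁−u₂‖)·exp(±i·∠(u₁−u₂, Ru₁−Ru₂)) } ⊆ ℂ`,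
with the convention `z_R(u₁,u₂) = {0}` if `Ru₁ = Ru₂`.  Here `∠` is the angle
`arccos(⟨u,y⟩/(‖u‖·‖y‖))` in a real Hilbert space. -/
noncomputable def zRel {E : Type*} [NormedAddCommGroup E] [InnerProductSpace ℝ E]
    (R : E → E) (u₁ u₂ : E) : Set ℂ :=
  if R u₁ = R u₂ then {0}
  else
    { (‖R u₁ - R u₂‖ / ‖u₁ - u₂‖ : ℝ) *
        Complex.exp ((InnerProductGeometry.angle (u₁ - u₂) (R u₁ - R u₂) : ℝ) * Complex.I),
      (‖R u₁ - R u₂‖ / ‖u₁ - u₂‖ : ℝ) *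
        Complex.exp (-((InnerProductGeometry.angle (u₁ - u₂) (R u₁ - R u₂) : ℝ) * Complex.I)) }

/-- The scaled relative graph of `R` over the input set `D`:
`SRG_D(R) = ⋃_{u₁ ≠ u₂ ∈ D} z_R(u₁,u₂)`. -/
noncomputable def SRG {E : Type*} [NormedAddCommGroup E] [InnerProductSpace ℝ E]
    (D : Set E) (R : E → E) : Set ℂ :=
  ⋃ u₁ ∈ D, ⋃ u₂ ∈ D, ⋃ (_ : u₁ ≠ u₂), zRel R u₁ u₂

section ScaledRelativeGraph

variable {E : Type*} [NormedAddCommGroup E] [InnerProductSpace ℝ E]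

theorem zRel_const_smul (R : E → E) {α : ℝ} (hα : α ≠ 0) (u₁ u₂ : E) :
    zRel (fun u => α • R u) u₁ u₂ = (fun z : ℂ => (α : ℂ) * z) '' zRel R u₁ u₂ := by
  by_cases h : R u₁ = R u₂
  · simp [zRel, h]
  have h' : α • R u₁ ≠ α • R u₂ := fun e => h (smul_right_injective E hα e)
  simp only [zRel, if_neg h, if_neg h', image_pair, ← smul_sub, norm_smul, Real.norm_eq_abs]
  rcases hα.lt_or_gt with hneg | hpos
  · rw [InnerProductGeometry.angle_smul_right_of_neg _ _ hneg,
      InnerProductGeometry.angle_neg_right, abs_of_neg hneg, pair_comm]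
    push_cast
    simp only [sub_mul, neg_sub, Complex.exp_sub, Complex.exp_pi_mul_I, Complex.exp_neg]
    congr 1
    · ring
    · congr 1
      ring
  · rw [InnerProductGeometry.angle_smul_right_of_pos _ _ hpos, abs_of_pos hpos]
    push_cast
    simp only [mul_div_assoc, mul_assoc]

theorem zRel_comp_smul (R : E → E) {α : ℝ} (hα : α ≠ 0) (u₁ u₂ : E) :
    zRel (fun u => R (α • u)) u₁ u₂ =
      (fun z : ℂ => (α : ℂ) * z) '' zRel R (α • u₁) (α • u₂) := by
  rw [← zRel_const_smul R hα]
  have h : α • R (α • u₁) = α • R (α • u₂) ↔ R (α • u₁) = R (α • u₂) :=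
    (smul_right_injective E hα).eq_iff
  simp only [zRel, h, ← smul_sub, InnerProductGeometry.angle_smul_smul hα, norm_smul,
    mul_div_mul_left _ _ (norm_ne_zero_iff.mpr hα)]

theorem mem_SRG {D : Set E} {R : E → E} {z : ℂ} :
    z ∈ SRG D R ↔ ∃ u₁ ∈ D, ∃ u₂ ∈ D, u₁ ≠ u₂ ∧ z ∈ zRel R u₁ u₂ := by
  simp only [SRG, mem_iUnion, exists_prop]

end ScaledRelativeGraph

/-- For a nonzero real `α`, the operators `αR : u ↦ α·(Ru)` (on
`dom R`) and `Rα : u ↦ R(α·u)` (on `α⁻¹·dom R`) satisfy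
`SRG(αR) = α·SRG(R)` and `SRG(Rα) = α·SRG(R)`. -/
theorem statement12 {H : Type*} [NormedAddCommGroup H] [InnerProductSpace ℝ H]
    (D : Set H) (R : H → H) (α : ℝ) (hα : α ≠ 0) :
    SRG D (fun u => α • R u) = (fun z : ℂ => (α : ℂ) * z) '' SRG D R ∧
    SRG { u : H | α • u ∈ D } (fun u => R (α • u)) =
      (fun z : ℂ => (α : ℂ) * z) '' SRG D R := by
  constructor
  · simp only [SRG, zRel_const_smul R hα, image_iUnion]
  · ext z
    simp only [mem_SRG, zRel_comp_smul R hα, mem_image, mem_ofPred_eq]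
    constructor
    · rintro ⟨u₁, h₁, u₂, h₂, hne, w, hw, rfl⟩
      exact ⟨w, ⟨_, h₁, _, h₂, fun e => hne (smul_right_injective H hα e), hw⟩, rfl⟩
    · rintro ⟨w, ⟨v₁, h₁, v₂, h₂, hne, hw⟩, rfl⟩
      refine ⟨α⁻¹ • v₁, ?_, α⁻¹ • v₂, ?_, fun e => hne (smul_right_injective H (inv_ne_zero hα) e),
        w, ?_, rfl⟩ <;> simpa only [smul_inv_smul₀ hα]
end

section
/- Let H be a real Hilbert space and R an operator with domain dom(R) ⊆ H. Define I + R on dom(R) by (I+R)u := u + Ru. Then SRG(I+R) = 1 + SRG(R), where 1 + S := { 1 + z : z ∈ S }. -/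
open MeasureTheory Complex Set
open scoped ENNReal Classical

/-- The conjugate pair `r * exp (± θ * I)` is determined by its real part and squared modulus. -/
theorem eq_polar_or_eq_polar_neg_iff (r θ : ℝ) (z : ℂ) :
    z = r * Complex.exp (θ * Complex.I) ∨ z = r * Complex.exp (-(θ * Complex.I)) ↔
      z.re = r * Real.cos θ ∧ Complex.normSq z = r ^ 2 := by
  have hneg : -((θ : ℂ) * Complex.I) = ((-θ : ℝ) : ℂ) * Complex.I := by push_cast; ring
  rw [hneg]
  simp only [Complex.ext_iff, Complex.re_ofReal_mul, Complex.im_ofReal_mul,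
    Complex.exp_ofReal_mul_I_re, Complex.exp_ofReal_mul_I_im, Real.cos_neg, Real.sin_neg,
    ← and_or_left, Complex.normSq_apply]
  refine and_congr_right fun hre => ?_
  rw [mul_neg, ← sq_eq_sq_iff_eq_or_eq_neg, hre]
  have hθ := Real.sin_sq_add_cos_sq θ
  constructor <;> intro h
  · linear_combination h + r ^ 2 * hθ
  · linear_combination h - r ^ 2 * hθ

theorem mem_zRel_iff {E : Type*} [NormedAddCommGroup E] [InnerProductSpace ℝ E]
    (R : E → E) {u₁ u₂ : E} (h : u₁ ≠ u₂) (z : ℂ) :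
    z ∈ zRel R u₁ u₂ ↔
      z.re * ‖u₁ - u₂‖ ^ 2 = inner ℝ (u₁ - u₂) (R u₁ - R u₂) ∧
        Complex.normSq z * ‖u₁ - u₂‖ ^ 2 = ‖R u₁ - R u₂‖ ^ 2 := by
  have hx : ‖u₁ - u₂‖ ≠ 0 := norm_ne_zero_iff.mpr (sub_ne_zero.mpr h)
  unfold zRel
  split_ifs with hR
  · simp only [mem_singleton_iff, hR, sub_self, inner_zero_right, norm_zero]
    constructor
    · rintro rfl
      simp
    · rintro ⟨-, h2⟩
      simpa [hx, sub_ne_zero.mpr h] using h2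
  · rw [mem_insert_iff, mem_singleton_iff, eq_polar_or_eq_polar_neg_iff,
      ← InnerProductGeometry.cos_angle_mul_norm_mul_norm]
    refine and_congr ?_ ?_
    · rw [← mul_left_inj' (pow_ne_zero 2 hx)]
      field_simp
    · rw [div_pow, eq_div_iff (pow_ne_zero 2 hx)]

theorem one_add_mem_zRel_id_add_iff {E : Type*} [NormedAddCommGroup E] [InnerProductSpace ℝ E]
    (R : E → E) {u₁ u₂ : E} (h : u₁ ≠ u₂) (z : ℂ) :
    1 + z ∈ zRel (fun u => u + R u) u₁ u₂ ↔ z ∈ zRel R u₁ u₂ := by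
  rw [mem_zRel_iff _ h, mem_zRel_iff _ h, add_sub_add_comm, inner_add_right,
    real_inner_self_eq_norm_sq, norm_add_sq_real, Complex.normSq_add]
  simp only [Complex.add_re, Complex.one_re, map_one, one_mul, Complex.conj_re]
  constructor <;> rintro ⟨h1, h2⟩ <;> constructor
  · linear_combination h1
  · linear_combination h2 - 2 * h1
  · linear_combination h1
  · linear_combination h2 + 2 * h1

/-- The operator `I + R : u ↦ u + Ru` on `dom R` satisfies
`SRG(I + R) = 1 + SRG(R)`. -/
theorem statement13 {H : Type*} [NormedAddCommGroup H] [InnerProductSpace ℝ H]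
    (D : Set H) (R : H → H) :
    SRG D (fun u => u + R u) = (fun z : ℂ => 1 + z) '' SRG D R := by
  ext w
  obtain ⟨z, rfl⟩ : ∃ z, w = 1 + z := ⟨w - 1, by ring⟩
  rw [(add_right_injective (1 : ℂ)).mem_set_image]
  simp only [SRG, mem_iUnion]
  exact exists_congr fun u₁ => exists_congr fun _ => exists_congr fun u₂ =>
    exists_congr fun _ => exists_congr fun h => one_add_mem_zRel_id_add_iff R h z
end

section
/- Let H be a real Hilbert space and let R, S be operators with domains in H such that 0 ∈ dom(R) ∩ dom(S) and R(0) = S(0) = 0; define R + S on dom(R) ∩ dom(S) by (R+S)u := Ru + Su. If at least one of SG₀(R), SG₀(S) satisfies the chord property, then SG₀(R+S) ⊆ SG₀(R) + SG₀(S), the Minkowski sum. -/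
open MeasureTheory Complex Set
open scoped ENNReal Classical Pointwise

/-- The scaled graph at zero of `R` over the input set `D`:
`SG₀(R) = ⋃_{0 ≠ u ∈ D} z_R(u, 0)`. -/
noncomputable def SG0 {E : Type*} [NormedAddCommGroup E] [InnerProductSpace ℝ E]
    (D : Set E) (R : E → E) : Set ℂ :=
  ⋃ u ∈ D, ⋃ (_ : u ≠ 0), zRel R u 0

/-- A set `S ⊆ ℂ` satisfies the chord property if for every `z ∈ S` the closed
segment `[z, conj z]` is contained in `S`. -/
def ChordProperty (S : Set ℂ) : Prop :=
  ∀ z ∈ S, segment ℝ z ((starRingEnd ℂ) z) ⊆ S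

theorem norm_mul_sin_angle_eq_norm_sub {E : Type*} [NormedAddCommGroup E]
    [InnerProductSpace ℝ E] {u : E} (hu : u ≠ 0) (y : E) :
    ‖y‖ * Real.sin (InnerProductGeometry.angle u y) =
      ‖y - (inner ℝ u y / ‖u‖ ^ 2) • u‖ := by
  have hu' : ‖u‖ ≠ 0 := norm_ne_zero_iff.mpr hu
  refine (sq_eq_sq₀ (mul_nonneg (norm_nonneg _) (InnerProductGeometry.sin_angle_nonneg _ _))
    (norm_nonneg _)).mp ?_
  rw [norm_sub_sq_real, norm_smul, inner_smul_right, real_inner_comm u y, mul_pow, mul_pow,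
    Real.sin_sq, Real.norm_eq_abs, sq_abs,
    ← InnerProductGeometry.cos_angle_mul_norm_mul_norm u y]
  field_simp
  ring

/-- The points of `z_R(u, 0)` are those with real part `⟨u, Ru⟩ / ‖u‖²` whose imaginary part has
absolute value the relative size of the component of `Ru` orthogonal to `u`. -/
theorem mem_zRel_zero_iff {E : Type*} [NormedAddCommGroup E] [InnerProductSpace ℝ E]
    {R : E → E} (hR : R 0 = 0) {u : E} (hu : u ≠ 0) {z : ℂ} :
    z ∈ zRel R u 0 ↔ z.re = inner ℝ u (R u) / ‖u‖ ^ 2 ∧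
      |z.im| = ‖R u - (inner ℝ u (R u) / ‖u‖ ^ 2) • u‖ / ‖u‖ := by
  have hu' : ‖u‖ ≠ 0 := norm_ne_zero_iff.mpr hu
  unfold zRel
  rw [hR, sub_zero, sub_zero]
  split_ifs with h
  · simp [h, Complex.ext_iff]
  · set θ := InnerProductGeometry.angle u (R u) with hθ
    have hre : inner ℝ u (R u) / ‖u‖ ^ 2 = ‖R u‖ / ‖u‖ * Real.cos θ := by
      rw [← InnerProductGeometry.cos_angle_mul_norm_mul_norm u (R u), ← hθ]
      field_simp
    have hpos : 0 ≤ ‖R u‖ / ‖u‖ * Real.sin θ :=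
      mul_nonneg (by positivity) (InnerProductGeometry.sin_angle_nonneg _ _)
    rw [← norm_mul_sin_angle_eq_norm_sub hu, hre, ← hθ, mul_div_right_comm, abs_eq hpos,
      Set.mem_insert_iff, Set.mem_singleton_iff, ← neg_mul, ← Complex.ofReal_neg,
      Complex.ext_iff, Complex.ext_iff, Complex.re_ofReal_mul, Complex.re_ofReal_mul,
      Complex.im_ofReal_mul, Complex.im_ofReal_mul, Complex.exp_ofReal_mul_I_re,
      Complex.exp_ofReal_mul_I_re, Complex.exp_ofReal_mul_I_im, Complex.exp_ofReal_mul_I_im,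
      Real.cos_neg, Real.sin_neg, mul_neg, ← and_or_left]

theorem mem_SG0_iff {E : Type*} [NormedAddCommGroup E] [InnerProductSpace ℝ E]
    {D : Set E} {R : E → E} {z : ℂ} :
    z ∈ SG0 D R ↔ ∃ u ∈ D, u ≠ 0 ∧ z ∈ zRel R u 0 := by
  simp only [SG0, Set.mem_iUnion, exists_prop]

theorem ChordProperty.mem_of_abs_im_le {S : Set ℂ} (hS : ChordProperty S) {w v : ℂ}
    (hw : w ∈ S) (hre : v.re = w.re) (him : |v.im| ≤ |w.im|) : v ∈ S := by
  by_cases h : w.im = 0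
  · have hv : v.im = 0 := by simpa [h] using him
    rwa [Complex.ext hre (hv.trans h.symm)]
  · have hq : |v.im / w.im| ≤ 1 := by
      rw [abs_div]
      exact div_le_one_of_le₀ him (abs_nonneg _)
    obtain ⟨h1, h2⟩ := abs_le.mp hq
    refine hS w hw ⟨(1 + v.im / w.im) / 2, (1 - v.im / w.im) / 2, by linarith, by linarith,
      by ring, Complex.ext ?_ ?_⟩
    · simp [hre]
      ring
    · simp
      field_simp
      ring

theorem SG0_add_subset_of_chordProperty_right {E : Type*} [NormedAddCommGroup E]
    [InnerProductSpace ℝ E] {DR DS : Set E} {R S : E → E} (hR : R 0 = 0) (hS : S 0 = 0)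
    (hchord : ChordProperty (SG0 DS S)) :
    SG0 (DR ∩ DS) (fun u => R u + S u) ⊆ SG0 DR R + SG0 DS S := by
  intro z hz
  obtain ⟨u, ⟨huR, huS⟩, hu, hz⟩ := mem_SG0_iff.mp hz
  obtain ⟨hre, him⟩ := (mem_zRel_zero_iff (by simp [hR, hS]) hu).mp hz
  simp only [inner_add_right, add_div, add_smul, add_sub_add_comm] at hre him
  set p := inner ℝ u (R u) / ‖u‖ ^ 2 with hp
  set q := inner ℝ u (S u) / ‖u‖ ^ 2 with hq
  set α := ‖R u - p • u‖ / ‖u‖ with hα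
  set β := ‖S u - q • u‖ / ‖u‖ with hβ
  have hα0 : 0 ≤ α := by positivity
  have hβ0 : 0 ≤ β := by positivity
  have hle : |(|z.im| - α)| ≤ β := by
    rw [him, hα, hβ, ← sub_div, abs_div, abs_norm]
    gcongr
    simpa using abs_norm_sub_norm_le (R u - p • u + (S u - q • u)) (R u - p • u)
  obtain ⟨a, ha, hab⟩ : ∃ a : ℝ, |a| = α ∧ |z.im - a| ≤ β := by
    rcases abs_cases z.im with ⟨h, -⟩ | ⟨h, -⟩ <;> rw [h] at hle
    · exact ⟨α, abs_of_nonneg hα0, hle⟩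
    · refine ⟨-α, by rw [abs_neg, abs_of_nonneg hα0], ?_⟩
      rwa [← abs_neg, neg_sub', neg_neg] at hle
  refine Set.mem_add.mpr ⟨⟨p, a⟩, mem_SG0_iff.mpr ⟨u, huR, hu,
    (mem_zRel_zero_iff hR hu).mpr ⟨rfl, ha⟩⟩, ⟨q, z.im - a⟩, ?_,
    Complex.ext hre.symm (add_sub_cancel a z.im)⟩
  exact hchord.mem_of_abs_im_le (w := ⟨q, β⟩) (mem_SG0_iff.mpr ⟨u, huS, hu,
    (mem_zRel_zero_iff hS hu).mpr ⟨rfl, abs_of_nonneg hβ0⟩⟩) rfl (hab.trans (le_abs_self β))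

/-- If `0 ∈ dom(R) ∩ dom(S)`, `R 0 = S 0 = 0`, and at least one of
`SG₀(R)`, `SG₀(S)` satisfies the chord property, then `SG₀(R + S) ⊆ SG₀(R) + SG₀(S)`
(Minkowski sum), where `R + S` is defined on `dom(R) ∩ dom(S)`. -/
theorem statement17 {H : Type*} [NormedAddCommGroup H] [InnerProductSpace ℝ H]
    (DR DS : Set H) (R S : H → H)
    (h0R : (0 : H) ∈ DR) (h0S : (0 : H) ∈ DS) (hR0 : R 0 = 0) (hS0 : S 0 = 0)
    (hchord : ChordProperty (SG0 DR R) ∨ ChordProperty (SG0 DS S)) :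
    SG0 (DR ∩ DS) (fun u => R u + S u) ⊆ SG0 DR R + SG0 DS S := by
  rcases hchord with hchord | hchord
  · rw [Set.inter_comm, add_comm (SG0 DR R)]
    simp only [add_comm (R _)]
    exact SG0_add_subset_of_chordProperty_right hS0 hR0 hchord
  · exact SG0_add_subset_of_chordProperty_right hR0 hS0 hchord
end
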